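/- arXiv:1311.0313 — 11 statements merged into one kernel-verified Lean document; each statement's English description precedes it below -/
import Mathlib

section
/- Let n ≥ 1 be a natural number, let f : ℝ → ℝ be continuous, and let F : ℝ → ℝ be differentiable with F'(t) = (-1)^n · f(t) for all t. If y : ℝ → ℝ is infinitely differentiable and satisfies y^(2n)(x) + f(y(x)) = 0 for all x ∈ ℝ, then the function I(x) = (y^(n)(x))²/2 + F(y(x)) + Σ_{j=0}^{n-1} (-1)^{n-j} · y^(j+1)(x) · y^(2n-j-1)(x) is constant on ℝ. -/
/-- Every iterated derivative of a smooth function is differentiable, with the next iterated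
derivative as its derivative. -/
lemma ContDiff.hasDerivAt_iteratedDeriv {y : ℝ → ℝ} (hy : ContDiff ℝ (⊤ : ℕ∞) y) (k : ℕ) (x : ℝ) :
    HasDerivAt (iteratedDeriv k y) (iteratedDeriv (k + 1) y x) x := by
  rw [iteratedDeriv_succ]
  exact (hy.differentiable_iteratedDeriv k (by exact_mod_cast ENat.natCast_lt_top k) x).hasDerivAt

/-- The derivative of the alternating sum of products of derivatives telescopes. -/
lemma ContDiff.hasDerivAt_sum_iteratedDeriv_mul {y : ℝ → ℝ} (hy : ContDiff ℝ (⊤ : ℕ∞) y) (n : ℕ)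
    (x : ℝ) :
    HasDerivAt (fun x ↦ ∑ j ∈ Finset.range n, (-1 : ℝ) ^ (n - j)
        * iteratedDeriv (j + 1) y x * iteratedDeriv (2 * n - j - 1) y x)
      ((-1 : ℝ) ^ n * iteratedDeriv 1 y x * iteratedDeriv (2 * n) y x
        - iteratedDeriv (n + 1) y x * iteratedDeriv n y x) x := by
  have key : (-1 : ℝ) ^ n * iteratedDeriv 1 y x * iteratedDeriv (2 * n) y x
        - iteratedDeriv (n + 1) y x * iteratedDeriv n y x
      = ∑ j ∈ Finset.range n,
        ((-1 : ℝ) ^ (n - j) * iteratedDeriv (j + 1) y x * iteratedDeriv (2 * n - j) y x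
          - (-1 : ℝ) ^ (n - (j + 1)) * iteratedDeriv (j + 1 + 1) y x
            * iteratedDeriv (2 * n - (j + 1)) y x) := by
    rw [Finset.sum_range_sub' (fun j ↦ (-1 : ℝ) ^ (n - j) * iteratedDeriv (j + 1) y x
      * iteratedDeriv (2 * n - j) y x)]
    simp [show 2 * n - n = n by omega]
  rw [key]
  refine HasDerivAt.fun_sum fun j hj ↦ ?_
  have hjn : j < n := Finset.mem_range.mp hj
  have h := ((hy.hasDerivAt_iteratedDeriv (j + 1) x).const_mul ((-1 : ℝ) ^ (n - j))).mul
    (hy.hasDerivAt_iteratedDeriv (2 * n - j - 1) x)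
  rw [show 2 * n - j - 1 + 1 = 2 * n - j by omega] at h
  refine h.congr_deriv ?_
  rw [show n - j = n - (j + 1) + 1 by omega, Nat.sub_sub, pow_succ]
  ring

/-- First integral associated with translation symmetry of `y^(2n) + f(y) = 0`. -/
theorem stmt_0 (n : ℕ) (hn : 1 ≤ n) (f F : ℝ → ℝ)
    (hf : Continuous f) (hF : Differentiable ℝ F)
    (hF' : ∀ t, deriv F t = (-1 : ℝ) ^ n * f t)
    (y : ℝ → ℝ) (hy : ContDiff ℝ (⊤ : ℕ∞) y)
    (heq : ∀ x, iteratedDeriv (2 * n) y x + f (y x) = 0) :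
    ∃ C : ℝ, ∀ x : ℝ,
      (iteratedDeriv n y x) ^ 2 / 2 + F (y x)
        + ∑ j ∈ Finset.range n, (-1 : ℝ) ^ (n - j)
            * iteratedDeriv (j + 1) y x * iteratedDeriv (2 * n - j - 1) y x = C := by
  have hI : ∀ x, HasDerivAt (fun x ↦ (iteratedDeriv n y x) ^ 2 / 2 + F (y x)
      + ∑ j ∈ Finset.range n, (-1 : ℝ) ^ (n - j)
          * iteratedDeriv (j + 1) y x * iteratedDeriv (2 * n - j - 1) y x) 0 x := by
    intro x
    have hy' : HasDerivAt y (iteratedDeriv 1 y x) x := by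
      simpa using hy.hasDerivAt_iteratedDeriv 0 x
    have hFy : HasDerivAt (fun x ↦ F (y x)) (deriv F (y x) * iteratedDeriv 1 y x) x :=
      (hF (y x)).hasDerivAt.comp x hy'
    refine (((((hy.hasDerivAt_iteratedDeriv n x).fun_pow 2).div_const 2).add hFy).add
      (hy.hasDerivAt_sum_iteratedDeriv_mul n x)).congr_deriv ?_
    rw [hF', eq_neg_of_add_eq_zero_left (heq x)]
    push_cast
    ring
  exact ⟨_, fun x ↦ is_const_of_deriv_eq_zero (fun x ↦ (hI x).differentiableAt)
    (fun x ↦ (hI x).deriv) x 0⟩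
end

section
/- Let n ≥ 1 be a natural number and λ ≠ 0 a real constant. For every infinitely differentiable y : ℝ → ℝ with y(x) > 0 for all x (no differential equation assumed), and for every x ∈ ℝ, the following algebraic identity holds: x²·I₁(x) − 2x·I₂(x) + I₃(x) = Σ_{j=1}^{n-1} (-1)^{n-j-1} · j(2n-j) · y^(j-1)(x) · y^(2n-j-1)(x) − (n²/2)·(y^(n-1)(x))², where I₁, I₂, I₃ are the quantities I₁(x) = (y^(n))²/2 + (-1)^n λ ((1-2n)/2) y^(2/(1-2n)) + Σ_{j=0}^{n-1} (-1)^{n-j} y^(j+1) y^(2n-j-1), I₂(x) = x(y^(n))²/2 + (-1)^n λ x ((1-2n)/2) y^(2/(1-2n)) + Σ_{j=0}^{n-1} (-1)^{n-j-1} (((2n-2j-1)/2) y^(j) − x y^(j+1)) y^(2n-j-1), and I₃(x) = (x²/2)(y^(n))² + (-1)^n λ x² ((1-2n)/2) y^(2/(1-2n)) − (n²/2)(y^(n-1))² + Σ_{j=0}^{n-1} (-1)^{n-j-1} ( j(2n-j) y^(j-1) + (2n-2j-1) x y^(j) − x² y^(j+1) ) y^(2n-j-1) (all evaluated at x). -/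
/-- The purely algebraic identity `x²·I₁ − 2x·I₂ + I₃ = Σ_{j=1}^{n-1} (-1)^{n-j-1} j(2n-j)
y^(j-1) y^(2n-j-1) − (n²/2)(y^(n-1))²`, valid for any smooth positive `y`. -/
theorem stmt_4 (n : ℕ) (hn : 1 ≤ n) (lam : ℝ) (hlam : lam ≠ 0)
    (y : ℝ → ℝ) (hy : ContDiff ℝ (⊤ : ℕ∞) y) (hpos : ∀ x, 0 < y x) (x : ℝ) :
    x ^ 2 *
      ((iteratedDeriv n y x) ^ 2 / 2
        + (-1 : ℝ) ^ n * lam * ((1 - 2 * (n : ℝ)) / 2) * (y x) ^ (2 / (1 - 2 * (n : ℝ)))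
        + ∑ j ∈ Finset.range n, (-1 : ℝ) ^ (n - j)
            * iteratedDeriv (j + 1) y x * iteratedDeriv (2 * n - j - 1) y x)
    - 2 * x *
      (x * (iteratedDeriv n y x) ^ 2 / 2
        + (-1 : ℝ) ^ n * lam * x * ((1 - 2 * (n : ℝ)) / 2) * (y x) ^ (2 / (1 - 2 * (n : ℝ)))
        + ∑ j ∈ Finset.range n, (-1 : ℝ) ^ (n - j - 1)
            * (((2 * (n : ℝ) - 2 * (j : ℝ) - 1) / 2) * iteratedDeriv j y x
                - x * iteratedDeriv (j + 1) y x)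
            * iteratedDeriv (2 * n - j - 1) y x)
    + ((x ^ 2 / 2) * (iteratedDeriv n y x) ^ 2
        + (-1 : ℝ) ^ n * lam * x ^ 2 * ((1 - 2 * (n : ℝ)) / 2)
            * (y x) ^ (2 / (1 - 2 * (n : ℝ)))
        - ((n : ℝ) ^ 2 / 2) * (iteratedDeriv (n - 1) y x) ^ 2
        + ∑ j ∈ Finset.range n, (-1 : ℝ) ^ (n - j - 1)
            * ((j : ℝ) * (2 * (n : ℝ) - (j : ℝ)) * iteratedDeriv (j - 1) y x
                + (2 * (n : ℝ) - 2 * (j : ℝ) - 1) * x * iteratedDeriv j y x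
                - x ^ 2 * iteratedDeriv (j + 1) y x)
            * iteratedDeriv (2 * n - j - 1) y x)
    = (∑ j ∈ Finset.Ico 1 n, (-1 : ℝ) ^ (n - j - 1)
          * ((j : ℝ) * (2 * (n : ℝ) - (j : ℝ)))
          * iteratedDeriv (j - 1) y x * iteratedDeriv (2 * n - j - 1) y x)
      - ((n : ℝ) ^ 2 / 2) * (iteratedDeriv (n - 1) y x) ^ 2 := by
  have hIco : (∑ j ∈ Finset.Ico 1 n, (-1 : ℝ) ^ (n - j - 1)
          * ((j : ℝ) * (2 * (n : ℝ) - (j : ℝ)))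
          * iteratedDeriv (j - 1) y x * iteratedDeriv (2 * n - j - 1) y x)
      = ∑ j ∈ Finset.range n, (-1 : ℝ) ^ (n - j - 1)
          * ((j : ℝ) * (2 * (n : ℝ) - (j : ℝ)))
          * iteratedDeriv (j - 1) y x * iteratedDeriv (2 * n - j - 1) y x := by
    rw [Finset.range_eq_Ico, Finset.sum_eq_sum_Ico_succ_bot hn]
    simp
  have hsum : x ^ 2 * (∑ j ∈ Finset.range n, (-1 : ℝ) ^ (n - j)
            * iteratedDeriv (j + 1) y x * iteratedDeriv (2 * n - j - 1) y x)
      - 2 * x * (∑ j ∈ Finset.range n, (-1 : ℝ) ^ (n - j - 1)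
            * (((2 * (n : ℝ) - 2 * (j : ℝ) - 1) / 2) * iteratedDeriv j y x
                - x * iteratedDeriv (j + 1) y x)
            * iteratedDeriv (2 * n - j - 1) y x)
      + (∑ j ∈ Finset.range n, (-1 : ℝ) ^ (n - j - 1)
            * ((j : ℝ) * (2 * (n : ℝ) - (j : ℝ)) * iteratedDeriv (j - 1) y x
                + (2 * (n : ℝ) - 2 * (j : ℝ) - 1) * x * iteratedDeriv j y x
                - x ^ 2 * iteratedDeriv (j + 1) y x)
            * iteratedDeriv (2 * n - j - 1) y x)
      = ∑ j ∈ Finset.range n, (-1 : ℝ) ^ (n - j - 1)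
          * ((j : ℝ) * (2 * (n : ℝ) - (j : ℝ)))
          * iteratedDeriv (j - 1) y x * iteratedDeriv (2 * n - j - 1) y x := by
    rw [Finset.mul_sum, Finset.mul_sum, ← Finset.sum_sub_distrib, ← Finset.sum_add_distrib]
    refine Finset.sum_congr rfl fun j hj => ?_
    have hsign : (-1 : ℝ) ^ (n - j) = -(-1 : ℝ) ^ (n - j - 1) := by
      have hlt := Finset.mem_range.mp hj
      rw [show n - j = n - j - 1 + 1 by omega, pow_succ]
      simp
    rw [hsign]
    ring
  rw [hIco, ← hsum]
  ring
end

section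
/- Let n ≥ 1 be a natural number and λ ≠ 0 a real constant. If y : ℝ → ℝ is infinitely differentiable, y(x) > 0 for all x, and y satisfies y^(2n)(x) + λ · y(x)^((1+2n)/(1-2n)) = 0 for all x ∈ ℝ, then there exist real constants c₀, c₁, c₂ such that for all x ∈ ℝ: Σ_{j=1}^{n-1} (-1)^{n-j} · j(2n-j) · y^(j-1)(x) · y^(2n-j-1)(x) + (n²/2)·(y^(n-1)(x))² = c₂·x² + c₁·x + c₀. -/
open Finset in
lemma sum_range_odd_of_symm (m : ℕ) (g : ℕ → ℝ) (hg : ∀ i < m, g (2 * m - i) = g i) :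
    ∑ i ∈ range (2 * m + 1), g i = 2 * ∑ i ∈ range m, g i + g m := by
  have h : ∑ i ∈ range m, g (m + 1 + i) = ∑ i ∈ range m, g i := by
    rw [← sum_range_reflect]
    refine sum_congr rfl fun i hi => ?_
    have hi := mem_range.1 hi
    rw [← hg i hi]
    congr 1
    omega
  rw [show 2 * m + 1 = m + 1 + m by ring, sum_range_add, sum_range_succ, h]
  ring

/-- A function whose third derivative vanishes is a quadratic polynomial. -/
lemma exists_quadratic_of_third_deriv_zero {f f₁ f₂ : ℝ → ℝ}
    (h : ∀ x, HasDerivAt f (f₁ x) x) (h₁ : ∀ x, HasDerivAt f₁ (f₂ x) x)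
    (h₂ : ∀ x, HasDerivAt f₂ 0 x) :
    ∃ c₀ c₁ c₂ : ℝ, ∀ x, f x = c₂ * x ^ 2 + c₁ * x + c₀ := by
  have const : ∀ g : ℝ → ℝ, (∀ x, HasDerivAt g 0 x) → ∀ x, g x = g 0 := fun g hg x =>
    is_const_of_deriv_eq_zero (fun x => (hg x).differentiableAt) (fun x => (hg x).deriv) x 0
  have e₂ := const f₂ h₂
  have e₁ := const (fun x => f₁ x - f₂ 0 * x) fun x => by
    have := (h₁ x).sub ((hasDerivAt_id x).const_mul (f₂ 0))
    exact this.congr_deriv (by simp [e₂ x])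
  have e₀ := const (fun x => f x - (f₂ 0 / 2 * x ^ 2 + f₁ 0 * x)) fun x => by
    have := (h x).sub ((((hasDerivAt_id x).pow 2).const_mul (f₂ 0 / 2)).add
      ((hasDerivAt_id x).const_mul (f₁ 0)))
    refine this.congr_deriv ?_
    have := e₁ x
    simp only [id, mul_zero, sub_zero] at this ⊢
    push_cast
    linarith
  refine ⟨f 0, f₁ 0, f₂ 0 / 2, fun x => ?_⟩
  have := e₀ x
  linarith

section BilinearForms

open Finset

variable {a : ℕ → ℝ → ℝ}

lemma hasDerivAt_sum_antidiagonal (ha : ∀ k x, HasDerivAt (a k) (a (k + 1) x) x)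
    (c : ℕ × ℕ → ℝ) (N : ℕ) (x : ℝ) :
    HasDerivAt (fun x => ∑ p ∈ antidiagonal N, c p * (a p.1 x * a p.2 x))
      (∑ p ∈ antidiagonal N, c p * (a (p.1 + 1) x * a p.2 x)
        + ∑ p ∈ antidiagonal N, c p * (a p.1 x * a (p.2 + 1) x)) x := by
  rw [← sum_add_distrib]
  refine HasDerivAt.fun_sum fun p _ => ?_
  refine (((ha p.1 x).mul (ha p.2 x)).const_mul (c p)).congr_deriv ?_
  ring

lemma hasDerivAt_sum_alternating_succ_mul_succ
    (ha : ∀ k x, HasDerivAt (a k) (a (k + 1) x) x) (N : ℕ) (x : ℝ) :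
    HasDerivAt (fun x => ∑ p ∈ antidiagonal N,
        ((-1) ^ p.1 * ((p.1 + 1 : ℝ) * (p.2 + 1))) * (a p.1 x * a p.2 x))
      (∑ p ∈ antidiagonal (N + 1), ((-1) ^ p.1 * ((p.2 : ℝ) - p.1)) * (a p.1 x * a p.2 x)) x := by
  refine (hasDerivAt_sum_antidiagonal ha
    (fun p => (-1) ^ p.1 * ((p.1 + 1 : ℝ) * (p.2 + 1))) N x).congr_deriv ?_
  have h₁ := Nat.sum_antidiagonal_succ (n := N)
    (f := fun p => -((-1) ^ p.1 * ((p.1 : ℝ) * (p.2 + 1))) * (a p.1 x * a p.2 x))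
  have h₂ := Nat.sum_antidiagonal_succ' (n := N)
    (f := fun p => ((-1) ^ p.1 * ((p.1 + 1 : ℝ) * p.2)) * (a p.1 x * a p.2 x))
  simp only [Nat.cast_zero, Nat.cast_add, Nat.cast_one, mul_zero, zero_mul, neg_zero, zero_add,
    pow_succ, mul_neg, mul_one, neg_mul, neg_neg] at h₁ h₂
  rw [← h₁, ← h₂, ← sum_add_distrib]
  exact sum_congr rfl fun p _ => by ring

lemma hasDerivAt_sum_alternating_sub
    (ha : ∀ k x, HasDerivAt (a k) (a (k + 1) x) x) (N : ℕ) (x : ℝ) :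
    HasDerivAt (fun x => ∑ p ∈ antidiagonal N,
        ((-1) ^ p.1 * ((p.2 : ℝ) - p.1)) * (a p.1 x * a p.2 x))
      (-2 * ∑ p ∈ antidiagonal (N + 1), (-1) ^ p.1 * (a p.1 x * a p.2 x)
        + (N + 2) * (1 - (-1) ^ N) * (a 0 x * a (N + 1) x)) x := by
  refine (hasDerivAt_sum_antidiagonal ha
    (fun p => (-1) ^ p.1 * ((p.2 : ℝ) - p.1)) N x).congr_deriv ?_
  have h₁ := Nat.sum_antidiagonal_succ (n := N)
    (f := fun p => -((-1) ^ p.1 * ((p.2 : ℝ) - p.1 + 1)) * (a p.1 x * a p.2 x))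
  have h₂ := Nat.sum_antidiagonal_succ' (n := N)
    (f := fun p => ((-1) ^ p.1 * ((p.2 : ℝ) - p.1 - 1)) * (a p.1 x * a p.2 x))
  have e₁ : ∑ p ∈ antidiagonal N, ((-1) ^ p.1 * ((p.2 : ℝ) - p.1)) * (a (p.1 + 1) x * a p.2 x)
      = ∑ p ∈ antidiagonal N, -((-1) ^ (p.1 + 1) * ((p.2 : ℝ) - (p.1 + 1 : ℕ) + 1))
          * (a (p.1 + 1) x * a p.2 x) :=
    sum_congr rfl fun p _ => by push_cast; ring
  have e₂ : ∑ p ∈ antidiagonal N, ((-1) ^ p.1 * ((p.2 : ℝ) - p.1)) * (a p.1 x * a (p.2 + 1) x)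
      = ∑ p ∈ antidiagonal N, ((-1) ^ p.1 * (((p.2 + 1 : ℕ) : ℝ) - p.1 - 1))
          * (a p.1 x * a (p.2 + 1) x) :=
    sum_congr rfl fun p _ => by push_cast; ring
  have e₃ : -2 * ∑ p ∈ antidiagonal (N + 1), (-1) ^ p.1 * (a p.1 x * a p.2 x)
      = ∑ p ∈ antidiagonal (N + 1), -((-1) ^ p.1 * ((p.2 : ℝ) - p.1 + 1)) * (a p.1 x * a p.2 x)
        + ∑ p ∈ antidiagonal (N + 1),
          ((-1) ^ p.1 * ((p.2 : ℝ) - p.1 - 1)) * (a p.1 x * a p.2 x) := by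
    rw [mul_sum, ← sum_add_distrib]
    exact sum_congr rfl fun p _ => by ring
  rw [e₃, h₁, h₂, e₁, e₂]
  push_cast
  ring

lemma hasDerivAt_sum_alternating
    (ha : ∀ k x, HasDerivAt (a k) (a (k + 1) x) x) (N : ℕ) (x : ℝ) :
    HasDerivAt (fun x => ∑ p ∈ antidiagonal N, (-1) ^ p.1 * (a p.1 x * a p.2 x))
      ((1 + (-1) ^ N) * (a 0 x * a (N + 1) x)) x := by
  refine (hasDerivAt_sum_antidiagonal ha (fun p => (-1) ^ p.1) N x).congr_deriv ?_
  have h₁ := Nat.sum_antidiagonal_succ (n := N)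
    (f := fun p => (-1) ^ p.1 * (a p.1 x * a p.2 x))
  have h₂ := Nat.sum_antidiagonal_succ' (n := N)
    (f := fun p => (-1) ^ p.1 * (a p.1 x * a p.2 x))
  simp only [pow_succ, mul_neg, mul_one, neg_mul, sum_neg_distrib, pow_zero, one_mul] at h₁ h₂
  linear_combination h₁ - h₂

end BilinearForms

/-- Combining the three first integrals via `x² I₁ − 2x I₂ + I₃`: on solutions of the
critical-exponent equation, a certain quadratic expression in `x` arises. -/
theorem stmt_5 (n : ℕ) (hn : 1 ≤ n) (lam : ℝ) (hlam : lam ≠ 0)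
    (y : ℝ → ℝ) (hy : ContDiff ℝ (⊤ : ℕ∞) y) (hpos : ∀ x, 0 < y x)
    (heq : ∀ x, iteratedDeriv (2 * n) y x
      + lam * (y x) ^ ((1 + 2 * (n : ℝ)) / (1 - 2 * (n : ℝ))) = 0) :
    ∃ c₀ c₁ c₂ : ℝ, ∀ x : ℝ,
      (∑ j ∈ Finset.Ico 1 n, (-1 : ℝ) ^ (n - j)
          * ((j : ℝ) * (2 * (n : ℝ) - (j : ℝ)))
          * iteratedDeriv (j - 1) y x * iteratedDeriv (2 * n - j - 1) y x)
        + ((n : ℝ) ^ 2 / 2) * (iteratedDeriv (n - 1) y x) ^ 2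
      = c₂ * x ^ 2 + c₁ * x + c₀ := by
  obtain ⟨m, rfl⟩ : ∃ m, n = m + 1 := ⟨n - 1, by omega⟩
  have ha : ∀ k x, HasDerivAt (iteratedDeriv k y) (iteratedDeriv (k + 1) y x) x := fun k x => by
    rw [iteratedDeriv_succ]
    exact ((hy.differentiable_iteratedDeriv k (by exact_mod_cast ENat.natCast_lt_top k)) x).hasDerivAt
  have hne : (1 - 2 * ((m + 1 : ℕ) : ℝ)) ≠ 0 := by
    push_cast
    have : (0 : ℝ) ≤ m := m.cast_nonneg
    intro h
    linarith
  have hode : ∀ x, (2 * (m : ℝ) + 1) * (y x * iteratedDeriv (2 * m + 3) y x)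
      + (2 * m + 3) * (iteratedDeriv 1 y x * iteratedDeriv (2 * m + 2) y x) = 0 := fun x => by
    set p := (1 + 2 * ((m + 1 : ℕ) : ℝ)) / (1 - 2 * ((m + 1 : ℕ) : ℝ)) with hp
    have hy₁ : HasDerivAt y (iteratedDeriv 1 y x) x := by simpa using ha 0 x
    have key := (ha (2 * m + 2) x).add ((hy₁.rpow_const (p := p) (.inl (hpos x).ne')).const_mul lam)
    have h₀ : (iteratedDeriv (2 * m + 2) y + fun x => lam * y x ^ p) = fun _ => 0 :=
      funext fun x => heq x
    have h₁ := key.unique (h₀ ▸ hasDerivAt_const x 0)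
    have h₂ : iteratedDeriv (2 * m + 2) y x + lam * y x ^ p = 0 := heq x
    have h₃ : y x ^ p = y x ^ (p - 1) * y x := by
      rw [← Real.rpow_add_one (hpos x).ne', sub_add_cancel]
    have h₄ : p * (2 * m + 1) = -(2 * m + 3) := by
      rw [hp, div_mul_eq_mul_div, div_eq_iff hne]
      push_cast
      ring
    rw [h₃] at h₂
    linear_combination (2 * (m : ℝ) + 1) * y x * h₁ + (2 * m + 3) * iteratedDeriv 1 y x * h₂
      - lam * iteratedDeriv 1 y x * y x ^ (p - 1) * y x * h₄
  obtain ⟨c₀, c₁, c₂, h⟩ := exists_quadratic_of_third_deriv_zero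
    (hasDerivAt_sum_alternating_succ_mul_succ ha (2 * m))
    (hasDerivAt_sum_alternating_sub ha (2 * m + 1)) (fun x => by
      refine (((hasDerivAt_sum_alternating ha (2 * m + 1 + 1) x).const_mul (-2)).add
        (((ha 0 x).mul (ha (2 * m + 1 + 1) x)).const_mul
          ((((2 * m + 1 : ℕ) : ℝ) + 2) * (1 - (-1) ^ (2 * m + 1))))).congr_deriv ?_
      have := hode x
      simp only [pow_succ, pow_mul, iteratedDeriv_zero, add_assoc, zero_add] at this ⊢
      norm_num at this ⊢
      have hsq : (-1 : ℝ) ^ (2 * m) = 1 := by simp [pow_mul]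
      linear_combination 2 * this
        - 2 * (y x * iteratedDeriv (2 * m + 3) y x) * hsq)
  refine ⟨(-1) ^ m / 2 * c₀, (-1) ^ m / 2 * c₁, (-1) ^ m / 2 * c₂, fun x => ?_⟩
  have hx := h x
  rw [Finset.Nat.sum_antidiagonal_eq_sum_range_succ_mk, sum_range_odd_of_symm] at hx
  · have hs : ∑ j ∈ Finset.Ico 1 (m + 1), (-1 : ℝ) ^ (m + 1 - j)
          * ((j : ℝ) * (2 * ((m + 1 : ℕ) : ℝ) - (j : ℝ)))
          * iteratedDeriv (j - 1) y x * iteratedDeriv (2 * (m + 1) - j - 1) y x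
        = (-1) ^ m * ∑ i ∈ Finset.range m, ((-1) ^ i * ((i + 1 : ℝ) * ((2 * m - i : ℕ) + 1)))
          * (iteratedDeriv i y x * iteratedDeriv (2 * m - i) y x) := by
      rw [Finset.sum_Ico_eq_sum_range, Finset.mul_sum]
      refine Finset.sum_congr rfl fun i hi => ?_
      have hi : i < m := by simpa using hi
      obtain ⟨d, rfl⟩ : ∃ d, m = i + d := ⟨m - i, by omega⟩
      rw [show i + d + 1 - (1 + i) = d by omega, show 1 + i - 1 = i by omega,
        show 2 * (i + d + 1) - (1 + i) - 1 = i + 2 * d by omega,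
        show 2 * (i + d) - i = i + 2 * d by omega, pow_add]
      have : ((-1 : ℝ) ^ i) * (-1) ^ i = 1 := by rw [← mul_pow]; simp
      push_cast
      linear_combination -(-1 : ℝ) ^ d * ((i + 1 : ℝ) * (i + 2 * d + 1))
        * (iteratedDeriv i y x * iteratedDeriv (i + 2 * d) y x) * this
    have hsq : ((-1 : ℝ) ^ m) * (-1) ^ m = 1 := by rw [← mul_pow]; simp
    rw [hs]
    simp only [show 2 * m - m = m by omega, Nat.add_sub_cancel] at hx ⊢
    push_cast at hx ⊢
    linear_combination (-1) ^ m / 2 * hx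
      - ((m : ℝ) + 1) ^ 2 / 2 * iteratedDeriv m y x ^ 2 * hsq
  · intro i hi
    obtain ⟨d, rfl⟩ : ∃ d, m = i + d := ⟨m - i, by omega⟩
    rw [show 2 * (i + d) - i = i + 2 * d by omega,
      show 2 * (i + d) - (i + 2 * d) = i by omega, pow_add, pow_mul]
    norm_num
    ring
end

section
/- Let λ be a real constant. If y : ℝ → ℝ is twice continuously differentiable, y(x) > 0 for all x, and y satisfies the Ermakov equation y''(x) + λ · y(x)^(-3) = 0 for all x ∈ ℝ, then there exist real constants a, b, c such that y(x)² = a·x² + b·x + c for all x ∈ ℝ. -/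
/-- A real function whose derivative vanishes everywhere equals its value at `0`. -/
theorem eq_apply_zero_of_hasDerivAt_zero {f : ℝ → ℝ} (hf : ∀ x, HasDerivAt f 0 x) (x : ℝ) :
    f x = f 0 :=
  is_const_of_deriv_eq_zero (fun t => (hf t).differentiableAt) (fun t => (hf t).deriv) x 0

/-- If `y` is nowhere zero and `y'' = -λ / y³`, then `y²` is a quadratic polynomial. -/
theorem exists_sq_eq_quadratic_of_ermakov {lam : ℝ} {y y' : ℝ → ℝ} (hne : ∀ x, y x ≠ 0)
    (hy : ∀ x, HasDerivAt y (y' x) x) (hy' : ∀ x, HasDerivAt y' (-lam / y x ^ 3) x) :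
    ∃ a b c : ℝ, ∀ x : ℝ, (y x) ^ 2 = a * x ^ 2 + b * x + c := by
  have energy : ∀ x, y' x ^ 2 - lam / y x ^ 2 = y' 0 ^ 2 - lam / y 0 ^ 2 := by
    refine eq_apply_zero_of_hasDerivAt_zero (f := fun x => y' x ^ 2 - lam / y x ^ 2) fun x => ?_
    have h := ((hy' x).fun_pow 2).fun_sub
      ((hasDerivAt_const x lam).fun_div ((hy x).fun_pow 2) (pow_ne_zero 2 (hne x)))
    refine h.congr_deriv ?_
    have := hne x
    field_simp
    ring
  set A := y' 0 ^ 2 - lam / y 0 ^ 2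
  have momentum : ∀ x, y x * y' x - A * x = y 0 * y' 0 - A * 0 := by
    refine eq_apply_zero_of_hasDerivAt_zero (f := fun x => y x * y' x - A * x) fun x => ?_
    have h := ((hy x).fun_mul (hy' x)).fun_sub ((hasDerivAt_id' x).const_mul A)
    refine h.congr_deriv ?_
    rw [← energy x]
    have := hne x
    field_simp
    ring
  set B := y 0 * y' 0 - A * 0
  have square : ∀ x, y x ^ 2 - A * x ^ 2 - 2 * B * x = y 0 ^ 2 - A * 0 ^ 2 - 2 * B * 0 := by
    refine eq_apply_zero_of_hasDerivAt_zero
      (f := fun x => y x ^ 2 - A * x ^ 2 - 2 * B * x) fun x => ?_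
    have h := (((hy x).fun_pow 2).fun_sub (((hasDerivAt_id' x).fun_pow 2).const_mul A)).fun_sub
      ((hasDerivAt_id' x).const_mul (2 * B))
    refine h.congr_deriv ?_
    rw [← momentum x]
    push_cast
    ring
  exact ⟨A, 2 * B, y 0 ^ 2, fun x => by linear_combination square x⟩

/-- For any positive solution of the Ermakov equation `y'' + λ y^{-3} = 0`,
the square `y²` is a quadratic polynomial in `x`. -/
theorem stmt_6 (lam : ℝ) (y : ℝ → ℝ) (hy : ContDiff ℝ 2 y) (hpos : ∀ x, 0 < y x)
    (heq : ∀ x, iteratedDeriv 2 y x + lam * (y x) ^ (-3 : ℝ) = 0) :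
    ∃ a b c : ℝ, ∀ x : ℝ, (y x) ^ 2 = a * x ^ 2 + b * x + c := by
  refine exists_sq_eq_quadratic_of_ermakov (lam := lam) (y' := deriv y) (fun x => (hpos x).ne')
    (fun x => (hy.differentiable (by norm_num) x).hasDerivAt) fun x => ?_
  have hd : Differentiable ℝ (deriv y) := by
    simpa [iteratedDeriv_one] using hy.differentiable_iteratedDeriv 1 (by norm_num)
  have hpow : y x ^ (-3 : ℝ) = (y x ^ 3)⁻¹ := by
    rw [Real.rpow_neg (hpos x).le]
    norm_cast
  have h2 : deriv (deriv y) x = -lam / y x ^ 3 := by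
    have h := heq x
    rw [iteratedDeriv_succ, iteratedDeriv_one, hpow] at h
    rw [div_eq_mul_inv]
    linear_combination h
  exact h2 ▸ (hd x).hasDerivAt
end

section
/- Let λ be a real constant. If y : ℝ → ℝ is infinitely differentiable, y(x) > 0 for all x, and y satisfies y''''(x) + λ · y(x)^(-5/3) = 0 for all x ∈ ℝ, then there exist real constants a, b, c such that −3·y(x)·y''(x) + 2·(y'(x))² = a·x² + b·x + c for all x ∈ ℝ. -/
theorem exists_forall_eq_of_hasDerivAt_zero {f : ℝ → ℝ} (hf : ∀ x, HasDerivAt f 0 x) :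
    ∃ c, ∀ x, f x = c :=
  ⟨f 0, fun x => is_const_of_deriv_eq_zero (fun x => (hf x).differentiableAt)
    (fun x => (hf x).deriv) x 0⟩

/-- A function whose third derivative vanishes is a quadratic polynomial. -/
theorem exists_quadratic_of_hasDerivAt {f f' f'' : ℝ → ℝ} (hf : ∀ x, HasDerivAt f (f' x) x)
    (hf' : ∀ x, HasDerivAt f' (f'' x) x) (hf'' : ∀ x, HasDerivAt f'' 0 x) :
    ∃ a b c : ℝ, ∀ x, f x = a * x ^ 2 + b * x + c := by
  obtain ⟨k, hk⟩ := exists_forall_eq_of_hasDerivAt_zero hf''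
  obtain ⟨m, hm⟩ := exists_forall_eq_of_hasDerivAt_zero (f := fun x => f' x - k * x) fun x => by
    refine ((hf' x).sub ((hasDerivAt_id' x).const_mul k)).congr_deriv ?_
    rw [hk]
    ring
  obtain ⟨n, hn⟩ := exists_forall_eq_of_hasDerivAt_zero
      (f := fun x => f x - (k / 2 * x ^ 2 + m * x)) fun x => by
    refine ((hf x).sub ((((hasDerivAt_id' x).pow 2).const_mul (k / 2)).add
      ((hasDerivAt_id' x).const_mul m))).congr_deriv ?_
    push_cast
    linear_combination hm x
  exact ⟨k / 2, m, n, fun x => by linear_combination hn x⟩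

theorem ContDiff.hasDerivAt_iteratedDeriv_s7 {f : ℝ → ℝ} (hf : ContDiff ℝ (⊤ : ℕ∞) f) (n : ℕ)
    (x : ℝ) : HasDerivAt (iteratedDeriv n f) (iteratedDeriv (n + 1) f x) x := by
  rw [iteratedDeriv_succ]
  exact (hf.differentiable_iteratedDeriv n (by exact_mod_cast ENat.natCast_lt_top n)
    x).hasDerivAt

/-- For any smooth positive solution of `y'''' + λ y^{-5/3} = 0`, the quantity
`−3yy'' + 2(y')²` is a quadratic polynomial in `x`. -/
theorem stmt_7 (lam : ℝ) (y : ℝ → ℝ) (hy : ContDiff ℝ (⊤ : ℕ∞) y) (hpos : ∀ x, 0 < y x)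
    (heq : ∀ x, iteratedDeriv 4 y x + lam * (y x) ^ (-5 / 3 : ℝ) = 0) :
    ∃ a b c : ℝ, ∀ x : ℝ,
      -3 * y x * iteratedDeriv 2 y x + 2 * (deriv y x) ^ 2 = a * x ^ 2 + b * x + c := by
  have h0 (x : ℝ) : HasDerivAt y (deriv y x) x := by
    simpa using hy.hasDerivAt_iteratedDeriv_s7 0 x
  have h1 (x : ℝ) : HasDerivAt (deriv y) (iteratedDeriv 2 y x) x := by
    simpa only [iteratedDeriv_one] using hy.hasDerivAt_iteratedDeriv_s7 1 x
  have h2 := hy.hasDerivAt_iteratedDeriv_s7 2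
  have h3 := hy.hasDerivAt_iteratedDeriv_s7 3
  refine exists_quadratic_of_hasDerivAt
    (f' := fun x => deriv y x * iteratedDeriv 2 y x - 3 * (y x * iteratedDeriv 3 y x))
    (f'' := fun x => iteratedDeriv 2 y x ^ 2 - 2 * (deriv y x * iteratedDeriv 3 y x)
      + 3 * lam * y x ^ (-2 / 3 : ℝ)) (fun x => ?_) (fun x => ?_) (fun x => ?_)
  · refine ((((h0 x).const_mul (-3)).mul (h2 x)).add
      (((h1 x).pow 2).const_mul 2)).congr_deriv ?_
    push_cast
    ring
  · refine (((h1 x).mul (h2 x)).sub (((h0 x).mul (h3 x)).const_mul 3)).congr_deriv ?_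
    have hrpow : y x ^ (-2 / 3 : ℝ) = y x ^ (-5 / 3 : ℝ) * y x := by
      rw [← Real.rpow_add_one (hpos x).ne']
      norm_num
    rw [hrpow]
    linear_combination (-3 * y x) * heq x
  · refine ((((h2 x).pow 2).sub (((h1 x).mul (h3 x)).const_mul 2)).add
      (((h0 x).rpow_const (p := -2 / 3) (Or.inl (hpos x).ne')).const_mul
        (3 * lam))).congr_deriv ?_
    rw [show (-2 / 3 - 1 : ℝ) = -5 / 3 by norm_num]
    push_cast
    linear_combination (-2 * deriv y x) * heq x
end

section
/- Let n ≥ 1 be a natural number and let α, β, γ ∈ ℝ with q(x) := α + 2βx + γx². Then for every x with q(x) > 0, the 2n-th derivative of the function x ↦ q(x)^((2n-1)/2) at x equals (-1)^n · ((2n)! / (2^n · n!))² · (β² − αγ)^n · q(x)^(-(2n+1)/2). -/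
open scoped Topology in
/-- The `2n`-th derivative of the `(n - 1/2)`-th power of a quadratic, on the set where the
quadratic is positive. The induction writes the next power as the quadratic times the previous one
and applies the Leibniz rule, in which only three terms survive. -/
theorem iteratedDeriv_quadratic_rpow_half (α β γ : ℝ) (n : ℕ) :
    ∀ x : ℝ, 0 < α + 2 * β * x + γ * x ^ 2 →
      iteratedDeriv (2 * n)
        (fun t : ℝ => (α + 2 * β * t + γ * t ^ 2) ^ ((2 * (n : ℝ) - 1) / 2)) x
      = (-1 : ℝ) ^ n
          * (((2 * n).factorial : ℝ) / (2 ^ n * (n.factorial : ℝ))) ^ 2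
          * (β ^ 2 - α * γ) ^ n
          * (α + 2 * β * x + γ * x ^ 2) ^ (-(2 * (n : ℝ) + 1) / 2) := by
  set q : ℝ → ℝ := fun t => α + 2 * β * t + γ * t ^ 2 with hqdef
  have hq_diff : ∀ t, HasDerivAt q (2 * β + 2 * γ * t) t := fun t => by
    have h := (((hasDerivAt_id t).const_mul (2 * β)).const_add α).add
      (((hasDerivAt_id t).pow 2).const_mul γ)
    refine h.congr_deriv ?_
    simp; ring
  have hq_smooth : ContDiff ℝ ⊤ q := by fun_prop
  have hq1 : iteratedDeriv 1 q = fun t => 2 * β + 2 * γ * t := by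
    rw [iteratedDeriv_one]; exact funext fun t => (hq_diff t).deriv
  have hq2 : iteratedDeriv 2 q = fun _ => 2 * γ := by
    rw [iteratedDeriv_succ, hq1]
    funext t
    simp
  have hq3 : ∀ k, iteratedDeriv (k + 3) q = fun _ => 0 := fun k => by
    induction k with
    | zero => rw [iteratedDeriv_succ, hq2]; funext t; simp
    | succ k ih => rw [iteratedDeriv_succ, ih]; funext t; simp
  have hpos : ∀ x, 0 < q x → ∀ᶠ t in 𝓝 x, 0 < q t := fun x hx =>
    hq_smooth.continuous.continuousAt.eventually_const_lt hx
  have hpow : ∀ s x, 0 < q x →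
      HasDerivAt (fun t => q t ^ s) ((2 * β + 2 * γ * x) * s * q x ^ (s - 1)) x :=
    fun s x hx => (hq_diff x).rpow_const (Or.inl hx.ne')
  induction n with
  | zero => intro x hx; simp
  | succ n ih =>
    intro x hx
    change 0 < q x at hx
    set c : ℝ := (-1 : ℝ) ^ n * (((2 * n).factorial : ℝ) / (2 ^ n * (n.factorial : ℝ))) ^ 2
          * (β ^ 2 - α * γ) ^ n with hc
    set f : ℝ → ℝ := fun t => q t ^ ((2 * (n : ℝ) - 1) / 2) with hf
    set s : ℝ := -(2 * (n : ℝ) + 1) / 2 with hs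
    have d0 : ∀ y, 0 < q y → iteratedDeriv (2 * n) f y = c * q y ^ s := ih
    have d1 : ∀ y, 0 < q y → iteratedDeriv (2 * n + 1) f y
        = c * ((2 * β + 2 * γ * y) * s * q y ^ (s - 1)) := fun y hy => by
      rw [iteratedDeriv_succ, Filter.EventuallyEq.deriv_eq ((hpos y hy).mono d0)]
      exact ((hpow s y hy).const_mul c).deriv
    have d2 : iteratedDeriv (2 * n + 2) f x
        = c * (2 * γ * s * q x ^ (s - 1)
          + (2 * β + 2 * γ * x) * s * ((2 * β + 2 * γ * x) * (s - 1) * q x ^ (s - 1 - 1))) := by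
      rw [iteratedDeriv_succ, Filter.EventuallyEq.deriv_eq ((hpos x hx).mono d1)]
      have h := ((((hasDerivAt_id x).const_mul (2 * γ)).const_add (2 * β)).mul_const s).mul
        (hpow (s - 1) x hx)
      refine ((h.const_mul c).congr_deriv ?_).deriv
      simp
    have hfs : ContDiffAt ℝ (2 * (n + 1) : ℕ) f x :=
      (hq_smooth.contDiffAt.of_le le_top).rpow_const_of_ne hx.ne'
    have hmul : (fun t : ℝ => q t ^ ((2 * ((n + 1 : ℕ) : ℝ) - 1) / 2)) =ᶠ[𝓝 x] q * f := by
      filter_upwards [hpos x hx] with t ht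
      rw [Pi.mul_apply, hf]
      dsimp only
      rw [← Real.rpow_one_add' ht.le (by have := n.cast_nonneg (α := ℝ); linarith)]
      push_cast
      ring_nf
    change iteratedDeriv (2 * (n + 1)) (fun t : ℝ => q t ^ ((2 * ((n + 1 : ℕ) : ℝ) - 1) / 2)) x
      = _ * q x ^ _
    rw [hmul.iteratedDeriv_eq, iteratedDeriv_mul (hq_smooth.contDiffAt.of_le le_top) hfs,
      show 2 * (n + 1) + 1 = 2 * n + 1 + 1 + 1 by ring, Finset.sum_range_succ',
      Finset.sum_range_succ', Finset.sum_range_succ', Finset.sum_eq_zero]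
    · have hr : ((2 * (n + 1)).factorial : ℝ) / (2 ^ (n + 1) * ((n + 1).factorial : ℝ))
          = (2 * n + 1) * (((2 * n).factorial : ℝ) / (2 ^ n * (n.factorial : ℝ))) := by
        rw [show 2 * (n + 1) = 2 * n + 1 + 1 by ring, Nat.factorial_succ (2 * n + 1),
          Nat.factorial_succ (2 * n), Nat.factorial_succ n]
        push_cast
        field_simp
        ring
      have e1 : q x ^ (s - 1) = q x * q x ^ (s - 1 - 1) := by
        rw [Real.rpow_sub_one hx.ne' (s - 1)]; field_simp
      have e0 : q x ^ s = q x * (q x * q x ^ (s - 1 - 1)) := by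
        rw [← e1, Real.rpow_sub_one hx.ne' s]; field_simp
      have e : -(2 * ((n + 1 : ℕ) : ℝ) + 1) / 2 = s - 1 := by rw [hs]; push_cast; ring
      rw [hr, e, show 0 + 1 + 1 = 2 by rfl, show 0 + 1 = 1 by rfl, hq1, hq2, iteratedDeriv_zero,
        show 2 * (n + 1) - 2 = 2 * n by lia, show 2 * (n + 1) - 1 = 2 * n + 1 by lia,
        show 2 * (n + 1) - 0 = 2 * n + 2 by lia, d0 x hx, d1 x hx, d2, e0, e1,
        Nat.cast_choose_two, Nat.choose_one_right, Nat.choose_zero_right]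
      generalize q x ^ (s - 1 - 1) = P
      simp only [hc, hs, hqdef]
      push_cast
      ring
    · intro i _
      rw [show i + 1 + 1 + 1 = i + 3 by ring, hq3]; simp

/-- The `2n`-th derivative of `(α + 2βx + γx²)^((2n-1)/2)` equals
`(-1)^n ((2n)!/(2^n n!))² (β² − αγ)^n (α + 2βx + γx²)^(-(2n+1)/2)` wherever the
quadratic is positive. -/
theorem stmt_9 (n : ℕ) (hn : 1 ≤ n) (α β γ : ℝ) (x : ℝ)
    (hq : 0 < α + 2 * β * x + γ * x ^ 2) :
    iteratedDeriv (2 * n)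
        (fun t : ℝ => (α + 2 * β * t + γ * t ^ 2) ^ ((2 * (n : ℝ) - 1) / 2)) x
      = (-1 : ℝ) ^ n
          * (((2 * n).factorial : ℝ) / (2 ^ n * (n.factorial : ℝ))) ^ 2
          * (β ^ 2 - α * γ) ^ n
          * (α + 2 * β * x + γ * x ^ 2) ^ (-(2 * (n : ℝ) + 1) / 2) :=
  iteratedDeriv_quadratic_rpow_half α β γ n x hq
end

section
/- Let n ≥ 1 be a natural number, λ ≠ 0 a real constant, and α, β, γ ∈ ℝ with β² − αγ ≠ 0 and (-1)^(n+1) · λ / (β² − αγ)^n > 0. Set A_n = ( (-1)^(n+1) · (λ / (β² − αγ)^n) · (2^n · n! / (2n)!)² )^((2n-1)/(4n)) and q(x) = α + 2βx + γx². Then for every x with q(x) > 0, the function y(x) = A_n · q(x)^((2n-1)/2) satisfies y^(2n)(x) + λ · y(x)^((1+2n)/(1-2n)) = 0. -/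
/-- Derivative of a quadratic polynomial. -/
theorem hasDerivAt_quadratic (α β γ x : ℝ) :
    HasDerivAt (fun t : ℝ => α + 2 * β * t + γ * t ^ 2) (2 * β + 2 * γ * x) x := by
  have h := (((hasDerivAt_id x).const_mul (2 * β)).const_add α).add
    (((hasDerivAt_id x).pow 2).const_mul γ)
  refine h.congr_deriv ?_
  simp
  ring

/-- Derivative of the derivative of a quadratic polynomial. -/
theorem hasDerivAt_affine (β γ x : ℝ) :
    HasDerivAt (fun t : ℝ => 2 * β + 2 * γ * t) (2 * γ) x := by
  simpa using ((hasDerivAt_id x).const_mul (2 * γ)).const_add (2 * β)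

theorem deriv_quadratic (α β γ : ℝ) :
    deriv (fun t : ℝ => α + 2 * β * t + γ * t ^ 2) = fun t => 2 * β + 2 * γ * t :=
  funext fun t => (hasDerivAt_quadratic α β γ t).deriv

theorem deriv_affine (β γ : ℝ) :
    deriv (fun t : ℝ => 2 * β + 2 * γ * t) = fun _ => 2 * γ :=
  funext fun t => (hasDerivAt_affine β γ t).deriv

/-- Third and higher derivatives of a quadratic polynomial vanish. -/
theorem iteratedDeriv_quadratic_eq_zero (α β γ : ℝ) (k : ℕ) :
    iteratedDeriv (k + 3) (fun t : ℝ => α + 2 * β * t + γ * t ^ 2) = 0 := by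
  rw [iteratedDeriv_succ', iteratedDeriv_succ', iteratedDeriv_succ', deriv_quadratic,
    deriv_affine]
  funext x
  simp

/-- Leibniz rule for the product of a quadratic polynomial and a smooth function. -/
theorem iteratedDeriv_quadratic_mul (α β γ : ℝ) {f : ℝ → ℝ} {x : ℝ} (m : ℕ)
    (hf : ContDiffAt ℝ (m + 2 : ℕ) f x) :
    iteratedDeriv (m + 2) (fun t => (α + 2 * β * t + γ * t ^ 2) * f t) x
      = (α + 2 * β * x + γ * x ^ 2) * iteratedDeriv (m + 2) f x
        + (m + 2) * (2 * β + 2 * γ * x) * iteratedDeriv (m + 1) f x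
        + (m + 2) * (m + 1) * γ * iteratedDeriv m f x := by
  have hchoose : ((m + 2).choose 2 : ℝ) = (m + 2) * (m + 1) / 2 := by
    rw [Nat.cast_choose_two]
    push_cast
    ring
  rw [iteratedDeriv_fun_mul (by fun_prop) hf, Finset.sum_range_succ', Finset.sum_range_succ',
    Finset.sum_range_succ', Finset.sum_eq_zero]
  · simp only [zero_add, Nat.choose_zero_right, Nat.choose_one_right, iteratedDeriv_zero,
      iteratedDeriv_one, iteratedDeriv_succ' (n := 1), deriv_quadratic, deriv_affine, hchoose,
      Nat.reduceAdd,
      Nat.add_sub_cancel, show m + 2 - 1 = m + 1 from rfl, Nat.sub_zero]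
    push_cast
    ring
  · intro i _
    rw [iteratedDeriv_quadratic_eq_zero]
    simp

/-- Derivative of a real power of a quadratic polynomial. -/
theorem hasDerivAt_quadratic_rpow (α β γ s : ℝ) {x : ℝ}
    (hx : 0 < α + 2 * β * x + γ * x ^ 2) :
    HasDerivAt (fun t => (α + 2 * β * t + γ * t ^ 2) ^ s)
      ((2 * β + 2 * γ * x) * s * (α + 2 * β * x + γ * x ^ 2) ^ (s - 1)) x :=
  (hasDerivAt_quadratic α β γ x).rpow_const (Or.inl hx.ne')

/-- The `2n`-th derivative of the `(n - 1/2)`-th power of a quadratic polynomial is a multiple of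
its `-(n + 1/2)`-th power. -/
theorem iteratedDeriv_quadratic_rpow (α β γ : ℝ) (n : ℕ) {x : ℝ}
    (hx : 0 < α + 2 * β * x + γ * x ^ 2) :
    iteratedDeriv (2 * n) (fun t => (α + 2 * β * t + γ * t ^ 2) ^ ((n : ℝ) - 1 / 2)) x
      = (-(β ^ 2 - α * γ)) ^ n * (((2 * n).factorial : ℝ) / (2 ^ n * n.factorial)) ^ 2
        * (α + 2 * β * x + γ * x ^ 2) ^ (-(n : ℝ) - 1 / 2) := by
  induction n generalizing x with
  | zero => simp
  | succ n ih =>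
    set q : ℝ → ℝ := fun t => α + 2 * β * t + γ * t ^ 2
    set f : ℝ → ℝ := fun t => q t ^ ((n : ℝ) - 1 / 2)
    set C : ℝ := (-(β ^ 2 - α * γ)) ^ n * (((2 * n).factorial : ℝ) / (2 ^ n * n.factorial)) ^ 2
      with hC
    set s : ℝ := -(n : ℝ) - 1 / 2 with hs
    have hcont : Continuous q := by fun_prop
    have hpos : ∀ {z : ℝ}, 0 < q z → ∀ᶠ t in nhds z, 0 < q t := fun hz =>
      hcont.continuousAt.eventually (lt_mem_nhds hz)
    have hprod : (fun t => q t ^ (((n + 1 : ℕ) : ℝ) - 1 / 2)) =ᶠ[nhds x] fun t => q t * f t := by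
      filter_upwards [hpos hx] with t ht
      rw [show ((n + 1 : ℕ) : ℝ) - 1 / 2 = 1 + ((n : ℝ) - 1 / 2) by push_cast; ring,
        Real.rpow_add ht, Real.rpow_one]
    have hsmooth : ContDiffAt ℝ (2 * n + 2 : ℕ) f x := by
      refine ContDiffAt.rpow_const_of_ne ?_ hx.ne'
      fun_prop
    have hd1 : ∀ {z : ℝ}, 0 < q z → iteratedDeriv (2 * n + 1) f z
        = C * ((2 * β + 2 * γ * z) * s * q z ^ (s - 1)) := by
      intro z hz
      have he : iteratedDeriv (2 * n) f =ᶠ[nhds z] fun t => C * q t ^ s := by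
        filter_upwards [hpos hz] with t ht using ih ht
      rw [iteratedDeriv_succ, he.deriv_eq]
      exact ((hasDerivAt_quadratic_rpow α β γ s hz).const_mul C).deriv
    have hd2 : iteratedDeriv (2 * n + 2) f x
        = C * (2 * γ * s * q x ^ (s - 1)
          + (2 * β + 2 * γ * x) * s * ((2 * β + 2 * γ * x) * (s - 1) * q x ^ (s - 1 - 1))) := by
      have he : iteratedDeriv (2 * n + 1) f
          =ᶠ[nhds x] fun t => C * ((2 * β + 2 * γ * t) * s * q t ^ (s - 1)) := by
        filter_upwards [hpos hx] with t ht using hd1 ht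
      rw [iteratedDeriv_succ, he.deriv_eq]
      exact ((((hasDerivAt_affine β γ x).mul_const s).mul
        (hasDerivAt_quadratic_rpow α β γ (s - 1) hx)).const_mul C).deriv
    have hleib := iteratedDeriv_quadratic_mul α β γ (2 * n) hsmooth
    have hpow : ∀ t : ℝ, q x ^ t = q x * q x ^ (t - 1) := by
      intro t
      rw [Real.rpow_sub_one hx.ne', mul_div_cancel₀ _ hx.ne']
    have hfac : ((2 * (n + 1)).factorial : ℝ) / (2 ^ (n + 1) * (n + 1).factorial)
        = (2 * n + 1) * (((2 * n).factorial : ℝ) / (2 ^ n * n.factorial)) := by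
      rw [show 2 * (n + 1) = 2 * n + 1 + 1 by ring, Nat.factorial_succ, Nat.factorial_succ,
        Nat.factorial_succ n]
      push_cast
      field_simp
      ring
    rw [show 2 * (n + 1) = 2 * n + 2 by ring] at hfac ⊢
    rw [hprod.iteratedDeriv_eq, hleib, hd1 hx, hd2, ih hx, hfac,
      show -((n + 1 : ℕ) : ℝ) - 1 / 2 = s - 1 by rw [hs]; push_cast; ring]
    have hC' : (-(β ^ 2 - α * γ)) ^ (n + 1)
        * ((2 * n + 1) * (((2 * n).factorial : ℝ) / (2 ^ n * n.factorial))) ^ 2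
        = -(β ^ 2 - α * γ) * (2 * n + 1) ^ 2 * C := by
      rw [hC]
      ring
    rw [hC', show α + 2 * β * x + γ * x ^ 2 = q x from rfl, hpow s, hpow (s - 1), hs]
    push_cast
    rw [show q x = α + 2 * β * x + γ * x ^ 2 from rfl]
    ring

/-- The three-parameter family of exact solutions
`y = A_n (α + 2βx + γx²)^((2n-1)/2)` of the critical-exponent equation
`y^(2n) + λ y^((1+2n)/(1-2n)) = 0`. -/
theorem stmt_10 (n : ℕ) (hn : 1 ≤ n) (lam : ℝ) (hlam : lam ≠ 0) (α β γ : ℝ)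
    (hd : β ^ 2 - α * γ ≠ 0)
    (hsign : 0 < (-1 : ℝ) ^ (n + 1) * lam / (β ^ 2 - α * γ) ^ n)
    (A : ℝ)
    (hA : A = ((-1 : ℝ) ^ (n + 1) * (lam / (β ^ 2 - α * γ) ^ n)
        * ((2 ^ n * (n.factorial : ℝ)) / ((2 * n).factorial : ℝ)) ^ 2)
        ^ ((2 * (n : ℝ) - 1) / (4 * (n : ℝ))))
    (q : ℝ → ℝ) (hq : ∀ t, q t = α + 2 * β * t + γ * t ^ 2)
    (y : ℝ → ℝ) (hy : ∀ t, y t = A * (q t) ^ ((2 * (n : ℝ) - 1) / 2))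
    (x : ℝ) (hqx : 0 < q x) :
    iteratedDeriv (2 * n) y x
      + lam * (y x) ^ ((1 + 2 * (n : ℝ)) / (1 - 2 * (n : ℝ))) = 0 := by
  obtain rfl : q = fun t => α + 2 * β * t + γ * t ^ 2 := funext hq
  set D : ℝ := β ^ 2 - α * γ
  set c : ℝ := ((2 * n).factorial : ℝ) / (2 ^ n * n.factorial) with hc
  set Q : ℝ := α + 2 * β * x + γ * x ^ 2 with hQ
  have hQpos : 0 < Q := hqx
  have hc0 : 0 < c := by positivity
  have hn1 : (1 : ℝ) ≤ n := by exact_mod_cast hn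
  have hn0 : (n : ℝ) ≠ 0 := by positivity
  have hp : (1 : ℝ) - 2 * n ≠ 0 := by linarith
  set B : ℝ := (-1 : ℝ) ^ (n + 1) * (lam / D ^ n)
    * ((2 ^ n * (n.factorial : ℝ)) / ((2 * n).factorial : ℝ)) ^ 2 with hBdef
  have hB : B = (-1 : ℝ) ^ (n + 1) * lam / D ^ n / c ^ 2 := by
    rw [hBdef, hc]
    field_simp
  have hB0 : 0 < B := by
    rw [hB]
    positivity
  have hA0 : 0 < A := hA ▸ Real.rpow_pos_of_pos hB0 _
  have hAp : A ^ ((1 + 2 * (n : ℝ)) / (1 - 2 * (n : ℝ))) = A * B⁻¹ := by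
    rw [show (1 + 2 * (n : ℝ)) / (1 - 2 * (n : ℝ)) = 1 + 4 * n / (1 - 2 * n) by
      field_simp; ring, Real.rpow_add hA0, Real.rpow_one]
    congr 1
    rw [hA, ← Real.rpow_mul hB0.le, ← Real.rpow_neg_one]
    congr 1
    field_simp
    ring
  have hy' : y = fun t => A * (α + 2 * β * t + γ * t ^ 2) ^ ((n : ℝ) - 1 / 2) := by
    funext t
    rw [hy, show (2 * (n : ℝ) - 1) / 2 = (n : ℝ) - 1 / 2 by ring]
  have hQp : (Q ^ ((n : ℝ) - 1 / 2)) ^ ((1 + 2 * (n : ℝ)) / (1 - 2 * (n : ℝ)))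
      = Q ^ (-(n : ℝ) - 1 / 2) := by
    rw [← Real.rpow_mul hQpos.le]
    congr 1
    rw [mul_div_assoc', div_eq_iff hp]
    ring
  have hcoef : (-D) ^ n * c ^ 2 + lam * B⁻¹ = 0 := by
    rw [hB, neg_pow]
    rcases neg_one_pow_eq_or ℝ n with h | h <;> 
      simp only [pow_succ, h] <;> field_simp <;> ring
  rw [hy', iteratedDeriv_const_mul_field, iteratedDeriv_quadratic_rpow α β γ n hqx,
    Real.mul_rpow hA0.le (by positivity), ← hQ, hQp, hAp]
  linear_combination A * Q ^ (-(n : ℝ) - 1 / 2) * hcoef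
end

section
/- Let λ, α, β, γ ∈ ℝ with β² − αγ ≠ 0 and λ/(β² − αγ) > 0, and set q(x) = α + 2βx + γx². Then for every x with q(x) > 0, the function y(x) = (λ/(β² − αγ))^(1/4) · √(q(x)) satisfies the Ermakov equation y''(x) + λ · y(x)^(-3) = 0. -/
theorem hasDerivAt_sqrt_quadratic (α β γ : ℝ) {t : ℝ} (ht : 0 < α + 2 * β * t + γ * t ^ 2) :
    HasDerivAt (fun t : ℝ => Real.sqrt (α + 2 * β * t + γ * t ^ 2))
      ((β + γ * t) / Real.sqrt (α + 2 * β * t + γ * t ^ 2)) t := by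
  have hquad : HasDerivAt (fun t : ℝ => α + 2 * β * t + γ * t ^ 2) (2 * (β + γ * t)) t := by
    have h := (((hasDerivAt_id' t).const_mul (2 * β)).const_add α).add
      ((hasDerivAt_pow 2 t).const_mul γ)
    refine h.congr_deriv ?_
    push_cast
    ring
  exact (hquad.sqrt ht.ne').congr_deriv (mul_div_mul_left _ _ two_ne_zero)

theorem iteratedDeriv_two_const_mul_sqrt_quadratic (c α β γ : ℝ) {x : ℝ}
    (hx : 0 < α + 2 * β * x + γ * x ^ 2) :
    iteratedDeriv 2 (fun t : ℝ => c * Real.sqrt (α + 2 * β * t + γ * t ^ 2)) x =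
      c * ((α * γ - β ^ 2) / Real.sqrt (α + 2 * β * x + γ * x ^ 2) ^ 3) := by
  have hev : ∀ᶠ t in nhds x, 0 < α + 2 * β * t + γ * t ^ 2 :=
    ContinuousAt.eventually_lt (by fun_prop) (by fun_prop) hx
  have hderiv : deriv (fun t : ℝ => c * Real.sqrt (α + 2 * β * t + γ * t ^ 2)) =ᶠ[nhds x]
      fun t => c * ((β + γ * t) / Real.sqrt (α + 2 * β * t + γ * t ^ 2)) := by
    filter_upwards [hev] with t ht
    exact ((hasDerivAt_sqrt_quadratic α β γ ht).const_mul c).deriv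
  have hs := Real.sqrt_pos.2 hx
  have hlin : HasDerivAt (fun t : ℝ => β + γ * t) γ x := by
    simpa using ((hasDerivAt_id' x).const_mul γ).const_add β
  rw [iteratedDeriv_succ, iteratedDeriv_one, hderiv.deriv_eq,
    ((hlin.fun_div (hasDerivAt_sqrt_quadratic α β γ hx) hs.ne').const_mul c).deriv]
  have hsq := Real.sq_sqrt hx.le
  generalize Real.sqrt (α + 2 * β * x + γ * x ^ 2) = s at hs hsq ⊢
  congr 1
  field_simp
  rw [hsq]
  ring

/-- Pinney's solution: `y = (λ/(β² − αγ))^(1/4) √(α + 2βx + γx²)` solves the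
Ermakov equation `y'' + λ y^{-3} = 0` wherever the quadratic is positive. -/
theorem stmt_11 (lam α β γ : ℝ) (hd : β ^ 2 - α * γ ≠ 0)
    (hsign : 0 < lam / (β ^ 2 - α * γ)) (x : ℝ)
    (hq : 0 < α + 2 * β * x + γ * x ^ 2) :
    iteratedDeriv 2
        (fun t : ℝ => (lam / (β ^ 2 - α * γ)) ^ ((1 : ℝ) / 4)
          * Real.sqrt (α + 2 * β * t + γ * t ^ 2)) x
      + lam * ((lam / (β ^ 2 - α * γ)) ^ ((1 : ℝ) / 4)
          * Real.sqrt (α + 2 * β * x + γ * x ^ 2)) ^ (-3 : ℝ) = 0 := by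
  rw [iteratedDeriv_two_const_mul_sqrt_quadratic _ α β γ hq]
  have hc := Real.rpow_pos_of_pos hsign ((1 : ℝ) / 4)
  have hc4 : ((lam / (β ^ 2 - α * γ)) ^ ((1 : ℝ) / 4)) ^ 4 = lam / (β ^ 2 - α * γ) := by
    rw [← Real.rpow_natCast, ← Real.rpow_mul hsign.le]
    norm_num
  have hs := Real.sqrt_pos.2 hq
  generalize (lam / (β ^ 2 - α * γ)) ^ ((1 : ℝ) / 4) = c at hc hc4 ⊢
  generalize Real.sqrt (α + 2 * β * x + γ * x ^ 2) = s at hs ⊢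
  have hlam : lam = c ^ 4 * (β ^ 2 - α * γ) := by rw [hc4, div_mul_cancel₀ _ hd]
  have hpow : (c * s) ^ (-3 : ℝ) = ((c * s) ^ 3)⁻¹ := by
    rw [Real.rpow_neg (mul_pos hc hs).le]
    norm_cast
  rw [hpow, hlam]
  field_simp
  ring
end

section
/- Let n ≥ 1 be a natural number, λ ≠ 0 a real constant, and ε ∈ ℝ. Suppose y : ℝ → ℝ is infinitely differentiable, y(x) > 0 for all x, and satisfies y^(2n)(x) + λ · y(x)^((1+2n)/(1-2n)) = 0 for all x ∈ ℝ. Define z(x) = (1 + εx)^(2n-1) · y( x/(1+εx) ). Then for every x with 1 + εx > 0, z satisfies z^(2n)(x) + λ · z(x)^((1+2n)/(1-2n)) = 0. -/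
open scoped ContDiff in
/-- Smoothness at a point passes to all iterated derivatives. -/
lemma ContDiffAt.iteratedDeriv_infty {f : ℝ → ℝ} {x : ℝ} (hf : ContDiffAt ℝ ∞ f x) (k : ℕ) :
    ContDiffAt ℝ ∞ (iteratedDeriv k f) x := by
  induction k with
  | zero => simpa using hf
  | succ k ih =>
    rw [iteratedDeriv_succ]
    exact ih.derivWithin (by simp)

open scoped ContDiff in
/-- Leibniz rule for the product of a smooth function with an affine function. -/
lemma iteratedDeriv_succ_affine_mul {f : ℝ → ℝ} {S : Set ℝ} (hS : IsOpen S) (ε : ℝ)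
    (hf : ∀ x ∈ S, ContDiffAt ℝ ∞ f x) (k : ℕ) :
    ∀ x ∈ S, iteratedDeriv (k + 1) (fun t => (1 + ε * t) * f t) x
      = (1 + ε * x) * iteratedDeriv (k + 1) f x + (k + 1) * ε * iteratedDeriv k f x := by
  have hd : ∀ j, ∀ x ∈ S, HasDerivAt (iteratedDeriv j f) (iteratedDeriv (j + 1) f x) x := by
    intro j x hx
    rw [iteratedDeriv_succ]
    exact (((hf x hx).iteratedDeriv_infty j).differentiableAt (by simp)).hasDerivAt
  have hs : ∀ x, HasDerivAt (fun t => 1 + ε * t) ε x := fun x => by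
    simpa using ((hasDerivAt_id x).const_mul ε).const_add 1
  induction k with
  | zero =>
    intro x hx
    have h := (hs x).mul (hd 0 x hx)
    simp only [iteratedDeriv_zero] at h
    rw [zero_add, iteratedDeriv_one]
    refine h.deriv.trans ?_
    simp
    ring
  | succ k ih =>
    intro x hx
    rw [iteratedDeriv_succ]
    have h := ((hs x).mul (hd (k + 1) x hx)).add ((hd k x hx).const_mul ((k + 1) * ε))
    have he : iteratedDeriv (k + 1) (fun t => (1 + ε * t) * f t) =ᶠ[nhds x] _ :=
      Filter.eventually_of_mem (hS.mem_nhds hx) ih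
    refine (h.congr_of_eventuallyEq he).deriv.trans ?_
    push_cast
    ring

open scoped ContDiff in
/-- Projective covariance of the `(k+1)`-st derivative acting on densities of weight `k`. -/
lemma iteratedDeriv_projective {y : ℝ → ℝ} (hy : ContDiff ℝ ∞ y) (ε : ℝ) (k : ℕ) :
    ∀ x, 0 < 1 + ε * x →
      iteratedDeriv (k + 1) (fun t => (1 + ε * t) ^ k * y (t / (1 + ε * t))) x
        = iteratedDeriv (k + 1) y (x / (1 + ε * x)) / (1 + ε * x) ^ (k + 2) := by
  have hS : IsOpen {x : ℝ | 0 < 1 + ε * x} := isOpen_lt (by fun_prop) (by fun_prop)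
  have hs : ∀ x, HasDerivAt (fun t => 1 + ε * t) ε x := fun x => by
    simpa using ((hasDerivAt_id x).const_mul ε).const_add 1
  have hd : ∀ j, ∀ x, 0 < 1 + ε * x →
      HasDerivAt (fun t => iteratedDeriv j y (t / (1 + ε * t)))
        (iteratedDeriv (j + 1) y (x / (1 + ε * x)) / (1 + ε * x) ^ 2) x := by
    intro j x hx
    have hu := (hasDerivAt_id x).div (hs x) hx.ne'
    have hj : HasDerivAt (iteratedDeriv j y) (iteratedDeriv (j + 1) y (x / (1 + ε * x)))
        (x / (1 + ε * x)) := by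
      rw [iteratedDeriv_succ]
      exact ((hy.contDiffAt.iteratedDeriv_infty j).differentiableAt (by simp)).hasDerivAt
    refine (hj.comp x hu).congr_deriv ?_
    simp only [id]
    ring
  induction k with
  | zero =>
    intro x hx
    have h := hd 0 x hx
    simp only [iteratedDeriv_zero] at h
    simpa using h.deriv
  | succ k ih =>
    intro x hx
    have hf : ∀ x ∈ {x : ℝ | 0 < 1 + ε * x},
        ContDiffAt ℝ ∞ (fun t => (1 + ε * t) ^ k * y (t / (1 + ε * t))) x := by
      intro x hx
      have hs' : ContDiffAt ℝ ∞ (fun t : ℝ => 1 + ε * t) x := by fun_prop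
      exact (hs'.pow k).mul (hy.contDiffAt.comp x (contDiffAt_id.div hs' (ne_of_gt hx)))
    have hL := iteratedDeriv_succ_affine_mul hS ε hf (k + 1) x hx
    have hfun : (fun t => (1 + ε * t) ^ (k + 1) * y (t / (1 + ε * t)))
        = fun t => (1 + ε * t) * ((1 + ε * t) ^ k * y (t / (1 + ε * t))) := by
      funext t
      ring
    have he : iteratedDeriv (k + 1) (fun t => (1 + ε * t) ^ k * y (t / (1 + ε * t)))
        =ᶠ[nhds x] _ := Filter.eventually_of_mem (hS.mem_nhds hx) ih
    have hq := ((hd (k + 1) x hx).div ((hs x).pow (k + 2)) (pow_pos hx _).ne')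
    have hD := (hq.congr_of_eventuallyEq he).deriv
    rw [← iteratedDeriv_succ] at hD
    rw [hfun, hL, hD, ih x hx]
    have hne := hx.ne'
    simp only [Pi.pow_apply, show k + 2 - 1 = k + 1 from rfl]
    push_cast
    generalize iteratedDeriv (k + 1 + 1) y (x / (1 + ε * x)) = a
    generalize iteratedDeriv (k + 1) y (x / (1 + ε * x)) = b
    generalize 1 + ε * x = s at *
    field_simp
    ring


/-- The finite projective symmetry generated by `X₃ = x² ∂/∂x + (2n-1)xy ∂/∂y` of the
critical-exponent equation: if `y` is a positive solution of
`y^(2n) + λ y^((1+2n)/(1-2n)) = 0`, then `z(x) = (1+εx)^(2n-1) y(x/(1+εx))` is a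
solution on the set `{x : 1 + εx > 0}`. -/
theorem stmt_16 (n : ℕ) (hn : 1 ≤ n) (lam : ℝ) (hlam : lam ≠ 0) (ε : ℝ)
    (y : ℝ → ℝ) (hy : ContDiff ℝ (⊤ : ℕ∞) y) (hpos : ∀ x, 0 < y x)
    (heq : ∀ x, iteratedDeriv (2 * n) y x
      + lam * (y x) ^ ((1 + 2 * (n : ℝ)) / (1 - 2 * (n : ℝ))) = 0)
    (z : ℝ → ℝ) (hz : ∀ t, z t = (1 + ε * t) ^ (2 * n - 1) * y (t / (1 + ε * t))) :
    ∀ x : ℝ, 0 < 1 + ε * x →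
      iteratedDeriv (2 * n) z x
        + lam * (z x) ^ ((1 + 2 * (n : ℝ)) / (1 - 2 * (n : ℝ))) = 0 := by
  intro x hx
  obtain ⟨k, hk⟩ : ∃ k, 2 * n = k + 1 := ⟨2 * n - 1, by omega⟩
  have hk' : 2 * n - 1 = k := by omega
  have hkr : 2 * (n : ℝ) = k + 1 := by exact_mod_cast hk
  have hk0 : (k : ℝ) ≠ 0 := by
    have : k ≠ 0 := by omega
    exact_mod_cast this
  have hz' : z = fun t => (1 + ε * t) ^ k * y (t / (1 + ε * t)) := by
    funext t
    rw [hz, hk']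
  have hp := hpos (x / (1 + ε * x))
  have h := heq (x / (1 + ε * x))
  have hpow : ((1 + ε * x) ^ k) ^ ((1 + 2 * (n : ℝ)) / (1 - 2 * (n : ℝ)))
      = ((1 + ε * x) ^ (k + 2))⁻¹ := by
    rw [← Real.rpow_natCast, ← Real.rpow_mul hx.le, ← Real.rpow_natCast, ← Real.rpow_neg hx.le]
    congr 1
    rw [hkr]
    push_cast
    have : (1 : ℝ) - (k + 1) ≠ 0 := by simpa using hk0
    field_simp
    ring
  rw [hz x, hk', Real.mul_rpow (pow_pos hx k).le hp.le, hpow, hz', hk,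
    iteratedDeriv_projective (by exact_mod_cast hy) ε k x hx, ← hk]
  have e : ∀ a b s : ℝ, a + lam * b = 0 → a / s + lam * (s⁻¹ * b) = 0 := by
    intro a b s hab
    rw [div_eq_mul_inv, show a * s⁻¹ + lam * (s⁻¹ * b) = (a + lam * b) * s⁻¹ by ring, hab, zero_mul]
  exact e _ _ _ h
end

section
/- Let n ≥ 1 be a natural number, λ ≠ 0 a real constant, and p a real number with p ≠ 1 and p ≠ −1. For infinitely differentiable positive y : ℝ → ℝ define the Lagrangian 𝓛[y](x) = (y^(n)(x))²/2 + (-1)^n · (λ/(p+1)) · y(x)^(p+1), and for c > 0 define (S_c y)(x) = c^(2n/(1-p)) · y(x/c). Then the following are equivalent: (i) p = (1+2n)/(1-2n); (ii) for every infinitely differentiable positive y : ℝ → ℝ, every c > 0, and all real a ≤ b, ∫_{c·a}^{c·b} 𝓛[S_c y](x) dx = ∫_a^b 𝓛[y](x) dx. -/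
/-- The scaling `y ↦ c ^ (2n / (1 - p)) * y (· / c)` multiplies the action
`∫ ((y⁽ⁿ⁾)² / 2 + K * y ^ (p + 1))` by a power of `c`. -/
theorem integral_scaled_lagrangian (n : ℕ) (K p : ℝ) (hp : p ≠ 1) {y : ℝ → ℝ}
    (hy : ContDiff ℝ n y) (hpos : ∀ x, 0 < y x) {c : ℝ} (hc : 0 < c) (a b : ℝ) :
    (∫ x in (c * a)..(c * b),
      ((iteratedDeriv n (fun t : ℝ => c ^ (2 * (n : ℝ) / (1 - p)) * y (t / c)) x) ^ 2 / 2
        + K * (c ^ (2 * (n : ℝ) / (1 - p)) * y (x / c)) ^ (p + 1)))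
      = c ^ (2 * (n : ℝ) * (1 + p) / (1 - p) + 1) *
        ∫ x in a..b, ((iteratedDeriv n y x) ^ 2 / 2 + K * (y x) ^ (p + 1)) := by
  have hp' : 1 - p ≠ 0 := sub_ne_zero.mpr hp.symm
  set α := 2 * (n : ℝ) / (1 - p) with hα
  set β := 2 * (n : ℝ) * (1 + p) / (1 - p) with hβ
  have hαβ : α * (p + 1) = β := by rw [hα, hβ]; ring
  have hαβ' : α * 2 - n * 2 = β := by rw [hα, hβ]; field_simp; ring
  have hderiv (x : ℝ) : iteratedDeriv n (fun t : ℝ => c ^ α * y (t / c)) (c * x)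
      = c ^ α * (c⁻¹ ^ n * iteratedDeriv n y x) := by
    simp only [div_eq_inv_mul]
    rw [iteratedDeriv_const_mul_field (c ^ α) (fun t => y (c⁻¹ * t)),
      iteratedDeriv_comp_const_mul hy]
    simp only [inv_mul_cancel_left₀ hc.ne']
  have hsq : (c ^ α * c⁻¹ ^ n) ^ 2 = c ^ β := by
    rw [← hαβ', Real.rpow_sub hc, Real.rpow_mul hc.le, Real.rpow_mul hc.le, Real.rpow_natCast,
      Real.rpow_two, Real.rpow_two, inv_pow, mul_pow, inv_pow, div_eq_mul_inv]
  rw [← intervalIntegral.smul_integral_comp_mul_left, smul_eq_mul, Real.rpow_add_one hc.ne',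
    mul_comm (c ^ β), mul_assoc, ← intervalIntegral.integral_const_mul (c ^ β)]
  refine congrArg (c * ·) (intervalIntegral.integral_congr fun x _ => ?_)
  rw [hderiv, mul_div_cancel_left₀ _ hc.ne',
    Real.mul_rpow (Real.rpow_nonneg hc.le _) (hpos x).le, ← Real.rpow_mul hc.le, hαβ,
    ← mul_assoc, mul_pow, hsq]
  ring

/-- Theorem 2 of the paper: the scaling `D_p` is a variational (Noether) symmetry of
the action of the Lagrangian `𝓛[y] = (y^(n))²/2 + (-1)^n (λ/(p+1)) y^(p+1)` if and
only if `p = (1+2n)/(1-2n)`. -/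
theorem stmt_17 (n : ℕ) (hn : 1 ≤ n) (lam : ℝ) (hlam : lam ≠ 0)
    (p : ℝ) (hp1 : p ≠ 1) (hp2 : p ≠ -1) :
    p = (1 + 2 * (n : ℝ)) / (1 - 2 * (n : ℝ)) ↔
    (∀ y : ℝ → ℝ, ContDiff ℝ (⊤ : ℕ∞) y → (∀ x, 0 < y x) →
      ∀ c : ℝ, 0 < c → ∀ a b : ℝ, a ≤ b →
        (∫ x in (c * a)..(c * b),
          ((iteratedDeriv n (fun t : ℝ => c ^ (2 * (n : ℝ) / (1 - p)) * y (t / c)) x) ^ 2 / 2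
            + (-1 : ℝ) ^ n * (lam / (p + 1))
              * (c ^ (2 * (n : ℝ) / (1 - p)) * y (x / c)) ^ (p + 1)))
        = ∫ x in a..b,
            ((iteratedDeriv n y x) ^ 2 / 2
              + (-1 : ℝ) ^ n * (lam / (p + 1)) * (y x) ^ (p + 1))) := by
  have hp' : 1 - p ≠ 0 := sub_ne_zero.mpr hp1.symm
  have hn1 : (1 : ℝ) ≤ n := by exact_mod_cast hn
  have hn' : 1 - 2 * (n : ℝ) ≠ 0 := by linarith
  have hexp : p = (1 + 2 * (n : ℝ)) / (1 - 2 * (n : ℝ)) ↔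
      2 * (n : ℝ) * (1 + p) / (1 - p) + 1 = 0 := by
    rw [eq_div_iff hn', div_add_one hp', div_eq_zero_iff, or_iff_left hp']
    constructor <;> intro h <;> linarith
  rw [hexp]
  constructor
  · intro h y hy hpos c hc a b _
    rw [integral_scaled_lagrangian n _ p hp1 (hy.of_le (by exact_mod_cast le_top)) hpos hc a b,
      h, Real.rpow_zero, one_mul]
  · intro h
    have h1 := h (fun _ => 1) contDiff_const (fun _ => one_pos) 2 two_pos 0 1 zero_le_one
    rw [integral_scaled_lagrangian n _ p hp1 contDiff_const (fun _ => one_pos) two_pos 0 1] at h1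
    have hK : (-1 : ℝ) ^ n * (lam / (p + 1)) ≠ 0 :=
      mul_ne_zero (pow_ne_zero _ (by norm_num))
        (div_ne_zero hlam fun h0 => hp2 (eq_neg_of_add_eq_zero_left h0))
    have hI : (∫ x in (0 : ℝ)..1, ((iteratedDeriv n (fun _ : ℝ => (1 : ℝ)) x) ^ 2 / 2
        + (-1 : ℝ) ^ n * (lam / (p + 1)) * (1 : ℝ) ^ (p + 1)))
        = (-1 : ℝ) ^ n * (lam / (p + 1)) := by
      simp [iteratedDeriv_const, Nat.one_le_iff_ne_zero.mp hn]
    rw [hI] at h1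
    have h2 := mul_eq_right₀ hK |>.mp h1
    exact (Real.rpow_right_inj two_pos (by norm_num)).mp (h2.trans (Real.rpow_zero 2).symm)
end

section
/- Let ξ, α, β : ℝ → ℝ and y : ℝ → ℝ be infinitely differentiable, and define ζ : ℕ → (ℝ → ℝ) recursively by ζ₀(x) = α(x)·y(x) + β(x) and ζ_{k+1}(x) = ζ_k'(x) − y^(k+1)(x)·ξ'(x). Then for every natural number p ≥ 1 and every x ∈ ℝ: ζ_p(x) = β^(p)(x) + α^(p)(x)·y(x) + Σ_{j=1}^{p} ( C(p,j)·α^(p-j)(x) − C(p,j-1)·ξ^(p-j+1)(x) ) · y^(j)(x), where C(p,j) denotes the binomial coefficient. -/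
/-- Characteristic form of the prolongation coefficients: with `Q = η - ξ y'`,
the recursion `ζ (k + 1) = D (ζ k) - y^(k+1) D ξ` is solved by
`ζ p = D^p Q + ξ y^(p+1)`. -/
theorem prolongation_eq_iteratedDeriv_characteristic {ξ η y : ℝ → ℝ}
    (hξ : ContDiff ℝ (⊤ : ℕ∞) ξ) (hη : ContDiff ℝ (⊤ : ℕ∞) η) (hy : ContDiff ℝ (⊤ : ℕ∞) y)
    {ζ : ℕ → ℝ → ℝ} (hζ0 : ∀ x, ζ 0 x = η x)
    (hζ : ∀ k x, ζ (k + 1) x = deriv (ζ k) x - iteratedDeriv (k + 1) y x * deriv ξ x) (p : ℕ) :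
    ζ p = fun x ↦ iteratedDeriv p (fun t ↦ η t - ξ t * deriv y t) x
      + ξ x * iteratedDeriv (p + 1) y x := by
  have hy' : ContDiff ℝ (⊤ : ℕ∞) (deriv y) := (contDiff_infty_iff_deriv.mp hy).2
  have hQ : ContDiff ℝ (⊤ : ℕ∞) (fun t ↦ η t - ξ t * deriv y t) := hη.sub (hξ.mul hy')
  induction p with
  | zero =>
    funext x
    simp [hζ0]
  | succ p ih =>
    funext x
    have hlt (n : ℕ) : (n : WithTop ℕ∞) < ((⊤ : ℕ∞) : WithTop ℕ∞) := by
      exact_mod_cast WithTop.coe_lt_top n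
    have hdQ := hQ.differentiable_iteratedDeriv p (hlt p) x
    have hdy := hy.differentiable_iteratedDeriv (p + 1) (hlt (p + 1)) x
    have hdξ : DifferentiableAt ℝ ξ x := hξ.differentiable (by simp) x
    rw [hζ, ih, deriv_fun_add hdQ (hdξ.fun_mul hdy), deriv_fun_mul hdξ hdy, ← iteratedDeriv_succ,
      ← iteratedDeriv_succ]
    ring

/-- Leibniz rule for iterated derivatives, with the derivatives of the second factor increasing. -/
theorem iteratedDeriv_fun_mul_eq_sum {f g : ℝ → ℝ} (hf : ContDiff ℝ (⊤ : ℕ∞) f)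
    (hg : ContDiff ℝ (⊤ : ℕ∞) g) (n : ℕ) (x : ℝ) :
    iteratedDeriv n (fun t ↦ f t * g t) x = ∑ j ∈ Finset.range (n + 1),
      (n.choose j : ℝ) * iteratedDeriv (n - j) f x * iteratedDeriv j g x := by
  have hle : (n : WithTop ℕ∞) ≤ ((⊤ : ℕ∞) : WithTop ℕ∞) := by exact_mod_cast le_top
  simp_rw [mul_comm (f _)]
  rw [iteratedDeriv_fun_mul (hg.contDiffAt.of_le hle) (hf.contDiffAt.of_le hle)]
  exact Finset.sum_congr rfl fun j _ ↦ by ring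

/-- Lemma 1 of the paper: closed form for the prolongation coefficients
`ζ_k = D(ζ_{k-1}) − y^(k) D(ξ)` with `ζ₀ = α y + β`. -/
theorem stmt_18 (ξ α β y : ℝ → ℝ)
    (hξ : ContDiff ℝ (⊤ : ℕ∞) ξ) (hα : ContDiff ℝ (⊤ : ℕ∞) α) (hβ : ContDiff ℝ (⊤ : ℕ∞) β)
    (hy : ContDiff ℝ (⊤ : ℕ∞) y)
    (ζ : ℕ → ℝ → ℝ)
    (hζ0 : ∀ x, ζ 0 x = α x * y x + β x)
    (hζ : ∀ k x, ζ (k + 1) x = deriv (ζ k) x - iteratedDeriv (k + 1) y x * deriv ξ x) :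
    ∀ p : ℕ, 1 ≤ p → ∀ x : ℝ,
      ζ p x = iteratedDeriv p β x + iteratedDeriv p α x * y x
        + ∑ j ∈ Finset.Icc 1 p,
            ((p.choose j : ℝ) * iteratedDeriv (p - j) α x
              - (p.choose (j - 1) : ℝ) * iteratedDeriv (p - j + 1) ξ x)
            * iteratedDeriv j y x := by
  intro p _ x
  have hy' : ContDiff ℝ (⊤ : ℕ∞) (deriv y) := (contDiff_infty_iff_deriv.mp hy).2
  have hle : (p : WithTop ℕ∞) ≤ ((⊤ : ℕ∞) : WithTop ℕ∞) := by exact_mod_cast le_top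
  have hαy := hα.mul hy
  have hsplit : iteratedDeriv p (fun t ↦ α t * y t + β t - ξ t * deriv y t) x
      = iteratedDeriv p (fun t ↦ α t * y t) x + iteratedDeriv p β x
        - iteratedDeriv p (fun t ↦ ξ t * deriv y t) x := by
    rw [iteratedDeriv_fun_sub ((hαy.add hβ).contDiffAt.of_le hle)
        ((hξ.mul hy').contDiffAt.of_le hle),
      iteratedDeriv_fun_add (hαy.contDiffAt.of_le hle) (hβ.contDiffAt.of_le hle)]
  have hIcc (F : ℕ → ℝ) : ∑ j ∈ Finset.Icc 1 p, F j = ∑ j ∈ Finset.range p, F (j + 1) := by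
    rw [Finset.range_eq_Ico, Finset.sum_Ico_add' F 0 p 1]
    rfl
  have hξsum : ∑ j ∈ Finset.range p,
      (p.choose j : ℝ) * iteratedDeriv (p - (j + 1) + 1) ξ x * iteratedDeriv (j + 1) y x
      = ∑ j ∈ Finset.range p,
        (p.choose j : ℝ) * iteratedDeriv (p - j) ξ x * iteratedDeriv (j + 1) y x := by
    refine Finset.sum_congr rfl fun j hj ↦ ?_
    rw [show p - (j + 1) + 1 = p - j by have := Finset.mem_range.mp hj; omega]
  rw [prolongation_eq_iteratedDeriv_characteristic hξ (hαy.add hβ) hy hζ0 hζ p]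
  dsimp only
  rw [hsplit, iteratedDeriv_fun_mul_eq_sum hα hy, iteratedDeriv_fun_mul_eq_sum hξ hy',
    Finset.sum_range_succ', Finset.sum_range_succ, hIcc]
  simp only [← iteratedDeriv_succ', sub_mul, Finset.sum_sub_distrib, Nat.add_sub_cancel, hξsum,
    Nat.choose_self, Nat.choose_zero_right, Nat.sub_self, Nat.sub_zero, iteratedDeriv_zero,
    Nat.cast_one]
  ring
end
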